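/- arXiv:2310.11914 — 2 statements merged into one kernel-verified Lean document; each statement's English description precedes it below -/
import Mathlib

section
/- Let γ_1, …, γ_n ∈ (0,1). Let μ_n be the entropic mirror descent iterates on F = KL(·|π) starting from μ_0, i.e. μ_{k+1} has density proportional to μ_k^{1-γ_{k+1}} π^{γ_{k+1}}. If KL(π|μ_0) < ∞ and KL(μ_0|π) < ∞, then KL(μ_n|π) ≤ (1/γ_1) · ∏_{k=1}^n (1−γ_k) · KL(π|μ_0). -/
open MeasureTheory Real

/-- The Kullback–Leibler divergence between two probability densities `f` and `g`
with respect to a reference measure `ρ`, `KL(f|g) = ∫ f log(f/g) dρ`. -/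
noncomputable def KL {E : Type*} [MeasurableSpace E] (ρ : Measure E) (f g : E → ℝ) : ℝ :=
  ∫ x, f x * Real.log (f x / g x) ∂ρ

/-- `f` is an everywhere-positive probability density with respect to `ρ`. -/
def IsProbDensity {E : Type*} [MeasurableSpace E] (ρ : Measure E) (f : E → ℝ) : Prop :=
  Measurable f ∧ (∀ x, 0 < f x) ∧ ∫ x, f x ∂ρ = 1

namespace IsProbDensity

variable {E : Type*} [MeasurableSpace E] {ρ : Measure E} {f g q : E → ℝ}

theorem integrable (hf : IsProbDensity ρ f) : Integrable f ρ := by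
  by_contra h
  have := hf.2.2
  rw [integral_undef h] at this
  exact zero_ne_one this

/-- **Gibbs' inequality** for densities. -/
theorem KL_nonneg (hf : IsProbDensity ρ f) (hg : IsProbDensity ρ g)
    (hfg : Integrable (fun x => f x * log (f x / g x)) ρ) : 0 ≤ KL ρ f g := by
  have h : ∫ x, (f x - g x) ∂ρ ≤ KL ρ f g := by
    refine integral_mono (hf.integrable.sub hg.integrable) hfg fun x => ?_
    have hfx := hf.2.1 x
    have hgx := hg.2.1 x
    have hlog : 1 - (f x / g x)⁻¹ ≤ log (f x / g x) := one_sub_inv_le_log_of_pos (by positivity)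
    calc f x - g x = f x * (1 - (f x / g x)⁻¹) := by field_simp
      _ ≤ f x * log (f x / g x) := by gcongr
  rwa [integral_sub hf.integrable hg.integrable, hf.2.2, hg.2.2, sub_self] at h

/-- A geometric mixture `q ∝ f ^ a * g ^ (1 - a)` is bounded by a multiple of `f + g`. -/
theorem le_of_log_div_eq (hf : IsProbDensity ρ f) (hg : IsProbDensity ρ g)
    (hq : IsProbDensity ρ q) {a c : ℝ} (ha₀ : 0 ≤ a) (ha₁ : a ≤ 1)
    (hlog : ∀ x, log (q x / g x) = a * log (f x / g x) - c) (x : E) :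
    q x ≤ exp (-c) * (f x + g x) := by
  have hfx := hf.2.1 x
  have hgx := hg.2.1 x
  have hqx := hq.2.1 x
  have hexp : exp (a * log (f x / g x)) ≤ f x / g x + 1 := by
    have hexp_log : exp (log (f x / g x)) = f x / g x := exp_log (by positivity)
    rcases le_total 0 (log (f x / g x)) with h | h
    · have : exp (a * log (f x / g x)) ≤ exp (log (f x / g x)) :=
        exp_le_exp.2 (mul_le_of_le_one_left h ha₁)
      linarith
    · have : exp (a * log (f x / g x)) ≤ 1 :=
        exp_le_one_iff.2 (mul_nonpos_of_nonneg_of_nonpos ha₀ h)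
      have : 0 < f x / g x := by positivity
      linarith
  calc q x = g x * exp (log (q x / g x)) := by rw [exp_log (by positivity)]; field_simp
    _ = exp (-c) * (g x * exp (a * log (f x / g x))) := by
      rw [hlog, sub_eq_add_neg, exp_add]; ring
    _ ≤ exp (-c) * (g x * (f x / g x + 1)) := by gcongr
    _ = exp (-c) * (f x + g x) := by field_simp

/-- If `q ∝ f ^ a * g ^ (1 - a)` with `a ∈ [0, 1)`, then
`KL(q|g) ≤ a / (1 - a) * KL(g|f)`. -/
theorem KL_le_of_log_div_eq (hf : IsProbDensity ρ f) (hg : IsProbDensity ρ g)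
    (hq : IsProbDensity ρ q) {a c : ℝ} (ha₀ : 0 ≤ a) (ha₁ : a < 1)
    (hlog : ∀ x, log (q x / g x) = a * log (f x / g x) - c)
    (hgf : Integrable (fun x => g x * log (g x / f x)) ρ)
    (hfg : Integrable (fun x => f x * log (f x / g x)) ρ) :
    KL ρ q g ≤ a / (1 - a) * KL ρ g f := by
  have hsymm : ∀ x, log (g x / f x) = -log (f x / g x) := fun x => by
    rw [← log_inv, inv_div]
  have hqint : Integrable (fun x => q x * log (f x / g x)) ρ := by
    refine ((hfg.norm.add hgf.norm).const_mul (exp (-c))).mono'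
      (hq.1.mul (hf.1.div hg.1).log).aestronglyMeasurable (ae_of_all _ fun x => ?_)
    have hfx := hf.2.1 x
    have hgx := hg.2.1 x
    have hqx := hq.2.1 x
    simp only [Pi.add_apply, norm_mul, norm_of_nonneg hfx.le, norm_of_nonneg hgx.le,
      norm_of_nonneg hqx.le, hsymm, norm_neg]
    rw [← add_mul, ← mul_assoc]
    gcongr
    exact hf.le_of_log_div_eq hg hq ha₀ ha₁.le hlog x
  have hqg : KL ρ q g = a * ∫ x, q x * log (f x / g x) ∂ρ - c := by
    calc KL ρ q g = ∫ x, (a * (q x * log (f x / g x)) - c * q x) ∂ρ :=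
          integral_congr_ae (ae_of_all _ fun x => by simp only [hlog]; ring)
      _ = _ := by
        rw [integral_sub (hqint.const_mul a) (hq.integrable.const_mul c), integral_const_mul,
          integral_const_mul, hq.2.2, mul_one]
  have hqf_eq : (fun x => q x * log (q x / f x)) =
      fun x => (a - 1) * (q x * log (f x / g x)) - c * q x := by
    funext x
    have hfx := (hf.2.1 x).ne'
    have hgx := (hg.2.1 x).ne'
    have hqx := (hq.2.1 x).ne'
    have h := hlog x
    rw [log_div hqx hgx] at h
    rw [log_div hqx hfx, show log (q x) = a * log (f x / g x) - c + log (g x) by linarith,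
      log_div hfx hgx]
    ring
  have hqf : 0 ≤ (a - 1) * ∫ x, q x * log (f x / g x) ∂ρ - c := by
    have h := hq.KL_nonneg hf (by
      rw [hqf_eq]; exact (hqint.const_mul _).sub (hq.integrable.const_mul c))
    rwa [KL, hqf_eq, integral_sub (hqint.const_mul _) (hq.integrable.const_mul c),
      integral_const_mul, integral_const_mul, hq.2.2, mul_one] at h
  have hgq_eq : (fun x => g x * log (g x / q x)) =
      fun x => a * (g x * log (g x / f x)) + c * g x := by
    funext x
    rw [← inv_div, log_inv, hlog, hsymm]
    ring
  have hgq : 0 ≤ a * KL ρ g f + c := by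
    have h := hg.KL_nonneg hq (by
      rw [hgq_eq]; exact (hgf.const_mul _).add (hg.integrable.const_mul c))
    rwa [KL, hgq_eq, integral_add (hgf.const_mul _) (hg.integrable.const_mul c),
      integral_const_mul, integral_const_mul, hg.2.2, mul_one] at h
  rw [hqg, div_mul_eq_mul_div, le_div_iff₀ (sub_pos.2 ha₁)]
  nlinarith [mul_nonneg ha₀ hqf]

end IsProbDensity

/-- The log-density ratio of the mirror descent iterates relative to the target contracts by
`∏ (1 - γ k)`, up to an additive constant. -/
theorem exists_log_div_eq_of_mirror_step {E : Type*} {p : E → ℝ} {μ : ℕ → E → ℝ} {γ : ℕ → ℝ}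
    {n : ℕ} (hp : ∀ x, 0 < p x) (hμ : ∀ k, k ≤ n → ∀ x, 0 < μ k x)
    (hstep : ∀ k, k < n → ∃ Z : ℝ, 0 < Z ∧
        ∀ x, μ (k + 1) x = (μ k x) ^ (1 - γ (k + 1)) * (p x) ^ (γ (k + 1)) / Z) :
    ∃ c : ℝ, ∀ x, log (μ n x / p x) =
      (∏ k ∈ Finset.Icc 1 n, (1 - γ k)) * log (μ 0 x / p x) - c := by
  induction n with
  | zero => exact ⟨0, fun x => by simp⟩
  | succ n ih =>
    obtain ⟨c, hc⟩ := ih (fun k hk => hμ k (by omega)) fun k hk => hstep k (by omega)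
    obtain ⟨Z, hZ, hμZ⟩ := hstep n (by omega)
    refine ⟨(1 - γ (n + 1)) * c + log Z, fun x => ?_⟩
    have hpx := hp x
    have hμx := hμ n (by omega) x
    have h := hc x
    rw [log_div hμx.ne' hpx.ne'] at h
    rw [Finset.prod_Icc_succ_top (by omega), log_div (hμ (n + 1) le_rfl x).ne' hpx.ne', hμZ,
      log_div (by positivity) hZ.ne', log_mul (by positivity) (by positivity), log_rpow hμx,
      log_rpow hpx]
    linear_combination (1 - γ (n + 1)) * h

/-- Entropic mirror descent on `F = KL(·|π)` with step sizes `γ_k ∈ (0,1)` satisfies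
`KL(μ_n|π) ≤ (1/γ_1)·∏_{k=1}^n (1-γ_k)·KL(π|μ_0)`. -/
theorem entropic_mirror_descent_rate_upper_bound
    {E : Type*} [MeasurableSpace E] (ρ : Measure E) [SigmaFinite ρ]
    (pi : E → ℝ) (μ : ℕ → E → ℝ) (γ : ℕ → ℝ) (n : ℕ) (hn : 1 ≤ n)
    (hγ : ∀ k, 1 ≤ k → k ≤ n → γ k ∈ Set.Ioo (0 : ℝ) 1)
    (hpi : IsProbDensity ρ pi)
    (hμ : ∀ k, k ≤ n → IsProbDensity ρ (μ k))
    (hstep : ∀ k, k < n → ∃ Z : ℝ, 0 < Z ∧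
        ∀ x, μ (k + 1) x = (μ k x) ^ (1 - γ (k + 1)) * (pi x) ^ (γ (k + 1)) / Z)
    (hKLfwd : Integrable (fun x => pi x * Real.log (pi x / μ 0 x)) ρ)
    (hKLbwd : Integrable (fun x => μ 0 x * Real.log (μ 0 x / pi x)) ρ) :
    KL ρ (μ n) pi ≤
      (1 / γ 1) * (∏ k ∈ Finset.Icc 1 n, (1 - γ k)) * KL ρ pi (μ 0) := by
  obtain ⟨c, hc⟩ :=
    exists_log_div_eq_of_mirror_step hpi.2.1 (fun k hk => (hμ k hk).2.1) hstep
  have hγ₁ := hγ 1 le_rfl hn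
  have hnonneg : ∀ k ∈ Finset.Icc 1 n, 0 ≤ 1 - γ k := fun k hk => by
    rw [Finset.mem_Icc] at hk
    linarith [(hγ k hk.1 hk.2).2]
  have hprod : ∏ k ∈ Finset.Icc 1 n, (1 - γ k) ≤ 1 - γ 1 := by
    rw [← Finset.mul_prod_erase _ _ (Finset.mem_Icc.2 ⟨le_rfl, hn⟩ : 1 ∈ Finset.Icc 1 n)]
    refine mul_le_of_le_one_right (by linarith [hγ₁.2]) (Finset.prod_le_one
      (fun k hk => hnonneg k (Finset.mem_of_mem_erase hk)) fun k hk => ?_)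
    have hk' := Finset.mem_Icc.1 (Finset.mem_of_mem_erase hk)
    linarith [(hγ k hk'.1 hk'.2).1]
  have hprod₀ := Finset.prod_nonneg hnonneg
  have hKL := hpi.KL_nonneg (hμ 0 n.zero_le) hKLfwd
  have hγ₁pos : 0 < γ 1 := hγ₁.1
  refine ((hμ 0 n.zero_le).KL_le_of_log_div_eq hpi (hμ n le_rfl) hprod₀ (by linarith) hc
    hKLfwd hKLbwd).trans ?_
  rw [one_div_mul_eq_div]
  gcongr
  linarith
end

section
/- Let μ be a probability measure with everywhere-positive density with respect to ρ, let γ ∈ (0,1], and let μ' be the probability measure with density proportional to μ^{1−γ} π^{γ}. If KL(μ|π) < ∞ and KL(μ'|π) < ∞, then KL(μ'|π) ≤ KL(μ|π) − (1/γ)·KL(μ|μ'). In particular, KL(μ|π) − KL(μ'|π) ≥ KL(μ|μ'), so the objective KL(·|π) decreases at each entropic mirror descent step by at least the KL divergence between consecutive iterates. -/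
open MeasureTheory Real

/-- A probability density is integrable. -/
theorem IsProbDensity.integrable_s7 {E : Type*} [MeasurableSpace E] {ρ : Measure E} {f : E → ℝ}
    (hf : IsProbDensity ρ f) : Integrable f ρ :=
  integrable_of_integral_eq_one hf.2.2

/-- Gibbs' inequality: the Kullback–Leibler divergence of probability densities is nonnegative. -/
theorem KL_nonneg {E : Type*} [MeasurableSpace E] {ρ : Measure E} {f g : E → ℝ}
    (hf : IsProbDensity ρ f) (hg : IsProbDensity ρ g) : 0 ≤ KL ρ f g := by
  unfold KL
  by_cases h : Integrable (fun x => f x * Real.log (f x / g x)) ρ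
  · calc (0 : ℝ) = ∫ x, (f x - g x) ∂ρ := by
          rw [integral_sub hf.integrable_s7 hg.integrable_s7, hf.2.2, hg.2.2, sub_self]
      _ ≤ _ := by
          refine integral_mono (hf.integrable_s7.sub hg.integrable_s7) h fun x => ?_
          have hfx := hf.2.1 x
          have hlog := Real.one_sub_inv_le_log_of_pos (div_pos hfx (hg.2.1 x))
          calc f x - g x = f x * (1 - (f x / g x)⁻¹) := by field_simp
            _ ≤ f x * Real.log (f x / g x) := mul_le_mul_of_nonneg_left hlog hfx.le
  · rw [integral_undef h]

/-- If `log (f / g)` is an affine function of `log (f / h)`, then `KL(f|g)` is the same affine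
function of `KL(f|h)`. -/
theorem KL_eq_of_log_div_eq {E : Type*} [MeasurableSpace E] {ρ : Measure E} {f g h : E → ℝ}
    {a b : ℝ} (hf : IsProbDensity ρ f)
    (hint : Integrable (fun x => f x * Real.log (f x / h x)) ρ)
    (hlog : ∀ x, Real.log (f x / g x) = a * Real.log (f x / h x) + b) :
    KL ρ f g = a * KL ρ f h + b := by
  have hpt : ∀ x, f x * Real.log (f x / g x) = a * (f x * Real.log (f x / h x)) + b * f x := by
    intro x
    rw [hlog]
    ring
  simp only [KL, hpt]
  rw [integral_add (hint.const_mul a) (hf.integrable_s7.const_mul b), integral_const_mul,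
    integral_const_mul, hf.2.2, mul_one]

/-- One step of entropic mirror descent `μ' ∝ μ^{1-γ} π^γ` with step size `γ ∈ (0,1]`
decreases the objective `KL(·|π)`:
`KL(μ'|π) ≤ KL(μ|π) - (1/γ)·KL(μ|μ')`; in particular
`KL(μ|π) - KL(μ'|π) ≥ KL(μ|μ')`. -/
theorem entropic_mirror_descent_step_decreases_KL
    {E : Type*} [MeasurableSpace E] (ρ : Measure E) [SigmaFinite ρ]
    (pi μ μ' : E → ℝ) (γ Z : ℝ) (hγ0 : 0 < γ) (hγ1 : γ ≤ 1)
    (hpi : IsProbDensity ρ pi) (hμ : IsProbDensity ρ μ)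
    (hZ : 0 < Z)
    (hstep : ∀ x, μ' x = (μ x) ^ (1 - γ) * (pi x) ^ γ / Z)
    (hμ' : IsProbDensity ρ μ')
    (h1 : Integrable (fun x => μ x * Real.log (μ x / pi x)) ρ)
    (h2 : Integrable (fun x => μ' x * Real.log (μ' x / pi x)) ρ) :
    KL ρ μ' pi ≤ KL ρ μ pi - (1 / γ) * KL ρ μ μ' ∧
    KL ρ μ μ' ≤ KL ρ μ pi - KL ρ μ' pi := by
  have hlog : ∀ x, Real.log (μ' x) =
      (1 - γ) * Real.log (μ x) + γ * Real.log (pi x) - Real.log Z := by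
    intro x
    have hμx := Real.rpow_pos_of_pos (hμ.2.1 x) (1 - γ)
    have hpix := Real.rpow_pos_of_pos (hpi.2.1 x) γ
    rw [hstep, Real.log_div (mul_pos hμx hpix).ne' hZ.ne', Real.log_mul hμx.ne' hpix.ne',
      Real.log_rpow (hμ.2.1 x), Real.log_rpow (hpi.2.1 x)]
  have hdiv : ∀ {f g : E → ℝ}, IsProbDensity ρ f → IsProbDensity ρ g → ∀ x,
      Real.log (f x / g x) = Real.log (f x) - Real.log (g x) :=
    fun hf hg x => Real.log_div (hf.2.1 x).ne' (hg.2.1 x).ne'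
  have hKL : KL ρ μ μ' = γ * KL ρ μ pi + Real.log Z := by
    refine KL_eq_of_log_div_eq hμ h1 fun x => ?_
    rw [hdiv hμ hμ', hdiv hμ hpi, hlog]
    ring
  have hbound : γ * KL ρ μ' pi ≤ -Real.log Z := by
    rcases hγ1.eq_or_lt with rfl | hγ
    · have hKL' : KL ρ μ' pi = 0 * KL ρ μ' pi + -Real.log Z := by
        refine KL_eq_of_log_div_eq hμ' h2 fun x => ?_
        rw [hdiv hμ' hpi, hlog]
        ring
      linarith
    · have hγ' : 0 < 1 - γ := sub_pos.mpr hγ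
      have hKL' : KL ρ μ' μ = -(γ / (1 - γ)) * KL ρ μ' pi + -(Real.log Z / (1 - γ)) := by
        refine KL_eq_of_log_div_eq hμ' h2 fun x => ?_
        rw [hdiv hμ' hμ, hdiv hμ' hpi, hlog]
        field_simp
        ring
      have hnonneg := mul_nonneg hγ'.le (KL_nonneg hμ' hμ)
      have hscaled : (1 - γ) * KL ρ μ' μ = -γ * KL ρ μ' pi - Real.log Z := by
        rw [hKL']
        field_simp
        ring
      linarith
  have hdescent : KL ρ μ' pi ≤ KL ρ μ pi - (1 / γ) * KL ρ μ μ' := by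
    have hrhs : KL ρ μ pi - (1 / γ) * KL ρ μ μ' = -Real.log Z / γ := by
      rw [hKL]
      field_simp
      ring
    rw [hrhs, le_div_iff₀ hγ0]
    linarith
  refine ⟨hdescent, ?_⟩
  have hle := le_mul_of_one_le_left (KL_nonneg hμ hμ') (one_le_one_div hγ0 hγ1)
  linarith
end
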